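/- Let μ be a finite positive Borel measure on 𝕋^d×𝕋^d, 𝕋 = ℝ/2πℤ, define r(ξ,η) = ∫ e^{i(ξ·p − η·q)} dμ(p,q), and assume r(ξ,0) = r(0,−ξ) for all ξ ∈ ℤ^d (equivalently, the two marginals of μ coincide). Then for every finitely supported f : ℤ^d → ℂ, with g(p) := Σ_{ξ∈ℤ^d} e^{−i p·ξ} f(ξ), one has 2 Re Σ_{ξ,η∈ℤ^d} [r(0,η−ξ) − r(ξ,η)] conj(f(ξ)) f(η) = ∫_{𝕋^d×𝕋^d} |g(p) − g(q)|² dμ(p,q). In particular the quadratic form Re Σ_{ξ,η}[r(0,η−ξ) − r(ξ,η)] conj(f(ξ)) f(η) is nonnegative. -/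

import Mathlib

open MeasureTheory Complex

noncomputable section

/-- The lattice `ℤ^d`. -/
abbrev ZLat (d : ℕ) := Fin d → ℤ

/-- The `d`-torus `𝕋^d = (ℝ/2πℤ)^d`. -/
abbrev Torus (d : ℕ) := Fin d → AddCircle (2 * Real.pi)

/-- The character `p ↦ e^{i ξ·p}` of the `d`-torus. -/
def torusChar {d : ℕ} (ξ : ZLat d) (p : Torus d) : ℂ :=
  ∏ i, (AddCircle.toCircle (ξ i • p i) : ℂ)

/-- The Fourier series `g(p) = Σ_ξ e^{−i p·ξ} f(ξ)` of a finitely supported `f`. -/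
def fourierSeries {d : ℕ} (f : ZLat d →₀ ℂ) (p : Torus d) : ℂ :=
  ∑ ξ ∈ f.support, (starRingEnd ℂ) (torusChar ξ p) * f ξ

theorem torusChar_sub {d : ℕ} (ξ η : ZLat d) (p : Torus d) :
    torusChar (ξ - η) p = torusChar ξ p * (starRingEnd ℂ) (torusChar η p) := by
  simp only [torusChar, Pi.sub_apply, sub_smul, sub_eq_add_neg (_ • _), AddCircle.toCircle_add,
    AddCircle.toCircle_neg, Circle.coe_mul, Circle.coe_inv_eq_conj, Finset.prod_mul_distrib,
    map_prod]

theorem torusChar_zero {d : ℕ} (p : Torus d) : torusChar 0 p = 1 := by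
  simp [torusChar]

theorem continuous_torusChar {d : ℕ} (ξ : ZLat d) : Continuous (torusChar (d := d) ξ) := by
  unfold torusChar
  refine continuous_finsetProd _ fun i _ => ?_
  exact continuous_subtype_val.comp
    (AddCircle.continuous_toCircle.comp ((continuous_apply i).zsmul (ξ i)))

theorem continuous_fourierSeries {d : ℕ} (f : ZLat d →₀ ℂ) : Continuous (fourierSeries f) := by
  unfold fourierSeries
  exact continuous_finsetSum _ fun ξ _ =>
    (continuous_conj.comp (continuous_torusChar ξ)).mul continuous_const

theorem integrable_of_continuous_of_compactSpace {X E : Type*} [TopologicalSpace X]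
    [CompactSpace X] [MeasurableSpace X] [OpensMeasurableSpace X] [NormedAddCommGroup E]
    [SecondCountableTopologyEither X E] {μ : Measure X} [IsFiniteMeasure μ] {F : X → E}
    (hF : Continuous F) : Integrable F μ :=
  integrableOn_univ.mp (hF.continuousOn.integrableOn_compact' isCompact_univ .univ)

theorem sum_integral_torusChar_mul_conj {d : ℕ} {X : Type*} [TopologicalSpace X]
    [CompactSpace X] [MeasurableSpace X] [OpensMeasurableSpace X] (μ : Measure X)
    [IsFiniteMeasure μ] {a b : X → Torus d} (ha : Continuous a) (hb : Continuous b)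
    (f : ZLat d →₀ ℂ) :
    ∑ ξ ∈ f.support, ∑ η ∈ f.support,
        (∫ x, torusChar ξ (a x) * (starRingEnd ℂ) (torusChar η (b x)) ∂μ) *
          (starRingEnd ℂ) (f ξ) * f η =
      ∫ x, (starRingEnd ℂ) (fourierSeries f (a x)) * fourierSeries f (b x) ∂μ := by
  have hint (ξ η : ZLat d) : Integrable (fun x => torusChar ξ (a x) *
      (starRingEnd ℂ) (torusChar η (b x)) * (starRingEnd ℂ) (f ξ) * f η) μ :=
    integrable_of_continuous_of_compactSpace <|
      ((((continuous_torusChar ξ).comp ha).mul (continuous_conj.comp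
        ((continuous_torusChar η).comp hb))).mul continuous_const).mul continuous_const
  simp only [← integral_mul_const]
  simp_rw [← integral_finsetSum _ fun η _ => hint _ η]
  rw [← integral_finsetSum _ fun ξ _ => integrable_finsetSum _ fun η _ => hint ξ η]
  congr 1 with x
  simp only [fourierSeries, map_sum, map_mul, conj_conj, Finset.sum_mul_sum]
  exact Finset.sum_congr rfl fun ξ _ => Finset.sum_congr rfl fun η _ => by ring

/-- **Dirichlet-form identity for the Lindblad generator.**  If `r` is the Fourier
transform of a finite positive measure `μ` on `𝕋^d × 𝕋^d` whose two marginals coincide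
(equivalently `r(ξ,0) = r(0,−ξ)`), then
`2 Re Σ_{ξ,η} [r(0,η−ξ) − r(ξ,η)] conj(f(ξ)) f(η) = ∫∫ |g(p) − g(q)|² dμ(p,q)`;
in particular the quadratic form is nonnegative. -/
theorem lindblad_dirichlet_form_identity
    (d : ℕ)
    (μ : Measure (Torus d × Torus d)) [IsFiniteMeasure μ]
    (r : ZLat d → ZLat d → ℂ)
    (hr : ∀ ξ η : ZLat d,
      r ξ η = ∫ pq, torusChar ξ pq.1 * (starRingEnd ℂ) (torusChar η pq.2) ∂μ)
    (hflux : ∀ ξ : ZLat d, r ξ 0 = r 0 (-ξ)) :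
    ∀ f : ZLat d →₀ ℂ,
      2 * (∑ ξ ∈ f.support, ∑ η ∈ f.support,
            (r 0 (η - ξ) - r ξ η) * (starRingEnd ℂ) (f ξ) * f η).re =
          ∫ pq, ‖fourierSeries f pq.1 - fourierSeries f pq.2‖ ^ 2 ∂μ ∧
      0 ≤ (∑ ξ ∈ f.support, ∑ η ∈ f.support,
            (r 0 (η - ξ) - r ξ η) * (starRingEnd ℂ) (f ξ) * f η).re := by
  intro f
  have : Fact (0 < 2 * Real.pi) := ⟨Real.two_pi_pos⟩
  set S := ∑ ξ ∈ f.support, ∑ η ∈ f.support,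
    (r 0 (η - ξ) - r ξ η) * (starRingEnd ℂ) (f ξ) * f η with hS
  have hr_snd (ξ η : ZLat d) : r 0 (η - ξ) =
      ∫ pq, torusChar ξ pq.2 * (starRingEnd ℂ) (torusChar η pq.2) ∂μ := by
    rw [hr]
    congr 1 with pq
    rw [torusChar_zero, torusChar_sub, one_mul, map_mul, conj_conj, mul_comm]
  have hr_fst (ξ η : ZLat d) : r 0 (η - ξ) =
      ∫ pq, torusChar ξ pq.1 * (starRingEnd ℂ) (torusChar η pq.1) ∂μ := by
    rw [← neg_sub ξ η, ← hflux, hr]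
    congr 1 with pq
    rw [torusChar_zero, torusChar_sub, map_one, mul_one]
  have hS_snd : S =
      ∫ pq, (starRingEnd ℂ) (fourierSeries f pq.2) * fourierSeries f pq.2 ∂μ -
        ∫ pq, (starRingEnd ℂ) (fourierSeries f pq.1) * fourierSeries f pq.2 ∂μ := by
    rw [← sum_integral_torusChar_mul_conj μ continuous_snd continuous_snd,
      ← sum_integral_torusChar_mul_conj μ continuous_fst continuous_snd]
    simp only [hS, ← hr, ← hr_snd, sub_mul, Finset.sum_sub_distrib]
  have hS_fst : S =
      ∫ pq, (starRingEnd ℂ) (fourierSeries f pq.1) * fourierSeries f pq.1 ∂μ -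
        ∫ pq, (starRingEnd ℂ) (fourierSeries f pq.1) * fourierSeries f pq.2 ∂μ := by
    rw [← sum_integral_torusChar_mul_conj μ continuous_fst continuous_fst,
      ← sum_integral_torusChar_mul_conj μ continuous_fst continuous_snd]
    simp only [hS, ← hr, ← hr_fst, sub_mul, Finset.sum_sub_distrib]
  have hint {a b : Torus d × Torus d → Torus d} (ha : Continuous a) (hb : Continuous b) :
      Integrable (fun x => (starRingEnd ℂ) (fourierSeries f (a x)) * fourierSeries f (b x)) μ :=
    integrable_of_continuous_of_compactSpace <|
      (continuous_conj.comp ((continuous_fourierSeries f).comp ha)).mul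
        ((continuous_fourierSeries f).comp hb)
  have h11 := hint continuous_fst continuous_fst
  have h12 := hint continuous_fst continuous_snd
  have h22 := hint continuous_snd continuous_snd
  rw [← integral_sub' h22 h12] at hS_snd
  rw [← integral_sub' h11 h12] at hS_fst
  have key : 2 * S.re = ∫ pq, ‖fourierSeries f pq.1 - fourierSeries f pq.2‖ ^ 2 ∂μ := by
    have hsum : 2 * S.re = (S + S).re := by rw [add_re, two_mul]
    rw [hsum]
    nth_rw 1 [hS_fst]
    rw [hS_snd, ← integral_add' (h11.sub h12) (h22.sub h12)]
    refine (integral_re ((h11.sub h12).add (h22.sub h12))).symm.trans ?_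
    congr 1 with pq
    simp only [Pi.add_apply, Pi.sub_apply, RCLike.re_to_complex, ← normSq_eq_norm_sq,
      normSq_apply, add_re, sub_re, mul_re, sub_im, conj_re, conj_im]
    ring
  have hnonneg : 0 ≤ ∫ pq, ‖fourierSeries f pq.1 - fourierSeries f pq.2‖ ^ 2 ∂μ :=
    integral_nonneg fun pq => sq_nonneg _
  exact ⟨key, by linarith⟩

end
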